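/- For any tetrahedron, (√3/4) · Diam(T) < rad(T) < Diam(T), i.e. the ratio rad(T)/Diam(T) lies strictly between √3/4 and 1. -/

import Mathlib

open scoped ENNReal

/-- The intrinsic (geodesic) distance on a subset `T` of `ℝ³`: the infimum of the lengths of
continuous paths from `x` to `y` staying in `T`. -/
noncomputable def rho (T : Set (EuclideanSpace ℝ (Fin 3)))
    (x y : EuclideanSpace ℝ (Fin 3)) : ℝ≥0∞ :=
  ⨅ (γ : ℝ → EuclideanSpace ℝ (Fin 3)) (_ : Continuous γ) (_ : γ 0 = x) (_ : γ 1 = y)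
    (_ : ∀ t ∈ Set.Icc (0 : ℝ) 1, γ t ∈ T), eVariationOn γ (Set.Icc 0 1)

/-- Intrinsic diameter. -/
noncomputable def intrinsicDiam (T : Set (EuclideanSpace ℝ (Fin 3))) : ℝ≥0∞ :=
  ⨆ x ∈ T, ⨆ y ∈ T, rho T x y

/-- Intrinsic radius. -/
noncomputable def intrinsicRad (T : Set (EuclideanSpace ℝ (Fin 3))) : ℝ≥0∞ :=
  ⨅ x ∈ T, ⨆ y ∈ T, rho T x y

/-- Extrinsic radius. -/
noncomputable def extrinsicRad (T : Set (EuclideanSpace ℝ (Fin 3))) : ℝ≥0∞ :=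
  ⨅ x ∈ T, ⨆ y ∈ T, edist x y

section TransportBounds

variable {V : Type*} [NormedAddCommGroup V]

theorem norm_smul_add_smul_le [NormedSpace ℝ V] {s t : ℝ} (hs : 0 ≤ s) (ht : 0 ≤ t)
    (u v : V) : ‖s • u + t • v‖ ≤ s * ‖u‖ + t * ‖v‖ := by
  refine (norm_add_le _ _).trans_eq ?_
  rw [norm_smul, norm_smul, Real.norm_of_nonneg hs, Real.norm_of_nonneg ht]

theorem norm_sub_le_two_mul {O A B : V} {R : ℝ} (hA : ‖A - O‖ ≤ R) (hB : ‖B - O‖ ≤ R) :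
    ‖A - B‖ ≤ 2 * R := by
  have h := norm_sub_le (A - O) (B - O)
  rw [sub_sub_sub_cancel_right] at h
  linarith

variable [InnerProductSpace ℝ V]

/-- The second moment of four masses `m, b, c, d` placed at points of norm at most `R`, written in
terms of mutual distances, is at most `(m + b + c + d)² R²`. -/
theorem sum_mul_dist_sq_le {A B C D : V} {R m b c d : ℝ}
    (hA : ‖A‖ ≤ R) (hB : ‖B‖ ≤ R) (hC : ‖C‖ ≤ R) (hD : ‖D‖ ≤ R)
    (hm : 0 ≤ m) (hb : 0 ≤ b) (hc : 0 ≤ c) (hd : 0 ≤ d) :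
    m * (b * ‖A - B‖ ^ 2 + c * ‖A - C‖ ^ 2 + d * ‖A - D‖ ^ 2)
      + b * c * ‖B - C‖ ^ 2 + b * d * ‖B - D‖ ^ 2 + c * d * ‖C - D‖ ^ 2
      ≤ (m + b + c + d) ^ 2 * R ^ 2 := by
  have key : m * (b * ‖A - B‖ ^ 2 + c * ‖A - C‖ ^ 2 + d * ‖A - D‖ ^ 2)
      + b * c * ‖B - C‖ ^ 2 + b * d * ‖B - D‖ ^ 2 + c * d * ‖C - D‖ ^ 2
      = (m + b + c + d) * (m * ‖A‖ ^ 2 + b * ‖B‖ ^ 2 + c * ‖C‖ ^ 2 + d * ‖D‖ ^ 2)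
        - ‖(m • A + b • B) + (c • C + d • D)‖ ^ 2 := by
    simp only [norm_add_sq_real, norm_sub_sq_real, inner_add_left, inner_add_right,
      real_inner_smul_left, real_inner_smul_right, norm_smul, mul_pow, Real.norm_eq_abs, sq_abs]
    ring
  have hsq : ∀ {X : V}, ‖X‖ ≤ R → ‖X‖ ^ 2 ≤ R ^ 2 := fun h =>
    pow_le_pow_left₀ (norm_nonneg _) h 2
  have hsum : m * ‖A‖ ^ 2 + b * ‖B‖ ^ 2 + c * ‖C‖ ^ 2 + d * ‖D‖ ^ 2 ≤ (m + b + c + d) * R ^ 2 := by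
    linarith [mul_le_mul_of_nonneg_left (hsq hA) hm, mul_le_mul_of_nonneg_left (hsq hB) hb,
      mul_le_mul_of_nonneg_left (hsq hC) hc, mul_le_mul_of_nonneg_left (hsq hD) hd]
  have := mul_le_mul_of_nonneg_left hsum (by positivity : 0 ≤ m + b + c + d)
  rw [key]
  nlinarith [sq_nonneg ‖(m • A + b • B) + (c • C + d • D)‖]

theorem vertex_cost_le {O A B C D : V} {R b c d : ℝ} (hR : 0 < R)
    (hA : ‖A - O‖ ≤ R) (hB : ‖B - O‖ ≤ R) (hC : ‖C - O‖ ≤ R) (hD : ‖D - O‖ ≤ R)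
    (hb : 0 ≤ b) (hc : 0 ≤ c) (hd : 0 ≤ d) :
    (b + c + d) * (b * ‖A - B‖ + c * ‖A - C‖ + d * ‖A - D‖)
      + b * c * ‖B - C‖ + b * d * ‖B - D‖ + c * d * ‖C - D‖
      ≤ 23 / 10 * R * (b + c + d) ^ 2 := by
  have hmom := sum_mul_dist_sq_le hA hB hC hD (by positivity : 0 ≤ 2 / 3 * (b + c + d)) hb hc hd
  simp only [sub_sub_sub_cancel_right] at hmom
  have hM : 0 ≤ b + c + d := by positivity
  have hlong : ∀ w e : ℝ, 0 ≤ w → (b + c + d) * w * (5 / 2 * R * e) ≤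
      (b + c + d) * w * (2 / 3 * e ^ 2 + 75 / 32 * R ^ 2) := fun w e hw =>
    mul_le_mul_of_nonneg_left (by nlinarith [sq_nonneg (e - 15 / 8 * R)]) (mul_nonneg hM hw)
  have hshort : ∀ w e : ℝ, 0 ≤ w → w * (5 / 2 * R * e) ≤ w * (e ^ 2 + 25 / 16 * R ^ 2) :=
    fun w e hw => mul_le_mul_of_nonneg_left (by nlinarith [sq_nonneg (e - 5 / 4 * R)]) hw
  have hσ : (b * c + b * d + c * d) * R ^ 2 ≤ (b + c + d) ^ 2 / 3 * R ^ 2 :=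
    mul_le_mul_of_nonneg_right
      (by nlinarith [sq_nonneg (b - c), sq_nonneg (b - d), sq_nonneg (c - d)]) (sq_nonneg R)
  have hMR : 0 ≤ (b + c + d) ^ 2 * R ^ 2 := by positivity
  have hfin : (5 / 2 * R) * ((b + c + d) * (b * ‖A - B‖ + c * ‖A - C‖ + d * ‖A - D‖)
      + b * c * ‖B - C‖ + b * d * ‖B - D‖ + c * d * ‖C - D‖)
      ≤ (5 / 2 * R) * (23 / 10 * R * (b + c + d) ^ 2) := by
    linarith [hlong b ‖A - B‖ hb, hlong c ‖A - C‖ hc, hlong d ‖A - D‖ hd,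
      hshort _ ‖B - C‖ (mul_nonneg hb hc), hshort _ ‖B - D‖ (mul_nonneg hb hd),
      hshort _ ‖C - D‖ (mul_nonneg hc hd)]
  exact le_of_mul_le_mul_left hfin (by positivity)

/-- `r` is at most the length of every route from `x` to `y` on a tetrahedron `ABCD` that either
crosses the edge `BC`, or crosses `AB` and then `BD`, or crosses `AC` and then `CD`. -/
structure RouteBound (A B C D x y : V) (r : ℝ) : Prop where
  viaBC : ∀ s t : ℝ, 0 ≤ s → 0 ≤ t → s + t = 1 →
    r ≤ ‖x - (s • B + t • C)‖ + ‖(s • B + t • C) - y‖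
  viaB : ∀ s t u v : ℝ, 0 ≤ s → 0 ≤ t → s + t = 1 → 0 ≤ u → 0 ≤ v → u + v = 1 →
    r ≤ ‖x - (s • A + t • B)‖ + ‖(s • A + t • B) - (u • D + v • B)‖ + ‖(u • D + v • B) - y‖
  viaC : ∀ s t u v : ℝ, 0 ≤ s → 0 ≤ t → s + t = 1 → 0 ≤ u → 0 ≤ v → u + v = 1 →
    r ≤ ‖x - (s • A + t • C)‖ + ‖(s • A + t • C) - (u • D + v • C)‖ + ‖(u • D + v • C) - y‖

theorem RouteBound.swap {A B C D x y : V} {r : ℝ} (h : RouteBound A B C D x y r) :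
    RouteBound A C B D x y r where
  viaBC s t hs ht hst := by
    simpa only [add_comm (s • C)] using h.viaBC t s ht hs (by linarith)
  viaB := h.viaC
  viaC := h.viaB

theorem RouteBound.reverse {A B C D x y : V} {r : ℝ} (h : RouteBound A B C D x y r) :
    RouteBound D B C A y x r where
  viaBC s t hs ht hst := by
    have := h.viaBC s t hs ht hst
    rw [norm_sub_rev y, norm_sub_rev _ x]
    linarith
  viaB s t u v hs ht hst hu hv huv := by
    have := h.viaB u v s t hu hv huv hs ht hst
    linarith [norm_sub_rev y (s • D + t • B), norm_sub_rev x (u • A + v • B),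
      norm_sub_rev (s • D + t • B) (u • A + v • B)]
  viaC s t u v hs ht hst hu hv huv := by
    have := h.viaC u v s t hu hv huv hs ht hst
    linarith [norm_sub_rev y (s • D + t • C), norm_sub_rev x (u • A + v • C),
      norm_sub_rev (s • D + t • C) (u • A + v • C)]

/-- The case in which `y` dominates `x` at both common vertices:
`y = (β + b) B + (γ + c) C + d D`. -/
theorem RouteBound.le_of_dominated {O A B C D : V} {R r β γ b c d : ℝ} (hR : 0 < R)
    (hA : ‖A - O‖ ≤ R) (hB : ‖B - O‖ ≤ R) (hC : ‖C - O‖ ≤ R) (hD : ‖D - O‖ ≤ R)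
    (hβ : 0 ≤ β) (hγ : 0 ≤ γ) (hb : 0 ≤ b) (hc : 0 ≤ c) (hd : 0 ≤ d)
    (hsum : b + c + d + β + γ = 1)
    (h : RouteBound A B C D ((b + c + d) • A + β • B + γ • C)
      ((β + b) • B + (γ + c) • C + d • D) r) :
    r ≤ 23 / 10 * R := by
  have f1 : r ≤ (b + d) * ‖A - B‖ + c * ‖A - C‖ + d * ‖B - D‖ := by
    have h0 := h.viaBC (β + b + d) (γ + c) (by positivity) (by positivity) (by linarith)
    have e1 : (b + c + d) • A + β • B + γ • C - ((β + b + d) • B + (γ + c) • C)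
      = (b + d) • (A - B) + c • (A - C) := by module
    have e2 : ((β + b + d) • B + (γ + c) • C) - ((β + b) • B + (γ + c) • C + d • D)
      = d • (B - D) + (0 : ℝ) • (0 : V) := by module
    rw [e1, e2] at h0
    have := norm_smul_add_smul_le (by positivity : 0 ≤ b + d) hc (A - B) (A - C)
    have := norm_smul_add_smul_le hd le_rfl (B - D) 0
    linarith
  have f2 : r ≤ b * ‖A - B‖ + (c + d) * ‖A - C‖ + d * ‖C - D‖ := by
    have h0 := h.viaBC (β + b) (γ + c + d) (by positivity) (by positivity) (by linarith)
    have e1 : (b + c + d) • A + β • B + γ • C - ((β + b) • B + (γ + c + d) • C)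
      = b • (A - B) + (c + d) • (A - C) := by module
    have e2 : ((β + b) • B + (γ + c + d) • C) - ((β + b) • B + (γ + c) • C + d • D)
      = d • (C - D) + (0 : ℝ) • (0 : V) := by module
    rw [e1, e2] at h0
    have := norm_smul_add_smul_le hb (by positivity : 0 ≤ c + d) (A - B) (A - C)
    have := norm_smul_add_smul_le hd le_rfl (C - D) 0
    linarith
  have f3 : r ≤ (b + c) * ‖A - B‖ + d * ‖A - D‖ + c * ‖B - C‖ + 2 * γ * ‖B - C‖ := by
    have h0 := h.viaB (b + c + d) (β + γ) d (β + b + (γ + c)) (by positivity) (by positivity)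
      (by linarith) hd (by positivity) (by linarith)
    have e1 : (b + c + d) • A + β • B + γ • C - ((b + c + d) • A + (β + γ) • B)
      = γ • (C - B) + (0 : ℝ) • (0 : V) := by module
    have e2 : ((b + c + d) • A + (β + γ) • B) - (d • D + (β + b + (γ + c)) • B)
      = (b + c) • (A - B) + d • (A - D) := by module
    have e3 : (d • D + (β + b + (γ + c)) • B) - ((β + b) • B + (γ + c) • C + d • D)
      = γ • (B - C) + c • (B - C) := by module
    rw [e1, e2, e3] at h0
    have := norm_smul_add_smul_le hγ le_rfl (C - B) 0
    have := norm_smul_add_smul_le (by positivity : 0 ≤ b + c) hd (A - B) (A - D)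
    have := norm_smul_add_smul_le hγ hc (B - C) (B - C)
    rw [norm_sub_rev C B] at *
    linarith
  have f4 : r ≤ b * ‖A - B‖ + (d + c) * ‖A - D‖ + c * ‖C - D‖ + 2 * γ * ‖B - C‖ := by
    have h0 := h.viaB (b + c + d) (β + γ) (d + c) (β + b + γ) (by positivity) (by positivity)
      (by linarith) (by positivity) (by positivity) (by linarith)
    have e1 : (b + c + d) • A + β • B + γ • C - ((b + c + d) • A + (β + γ) • B)
      = γ • (C - B) + (0 : ℝ) • (0 : V) := by module
    have e2 : ((b + c + d) • A + (β + γ) • B) - ((d + c) • D + (β + b + γ) • B)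
      = b • (A - B) + (d + c) • (A - D) := by module
    have e3 : ((d + c) • D + (β + b + γ) • B) - ((β + b) • B + (γ + c) • C + d • D)
      = γ • (B - C) + c • (D - C) := by module
    rw [e1, e2, e3] at h0
    have := norm_smul_add_smul_le hγ le_rfl (C - B) 0
    have := norm_smul_add_smul_le hb (by positivity : 0 ≤ d + c) (A - B) (A - D)
    have := norm_smul_add_smul_le hγ hc (B - C) (D - C)
    rw [norm_sub_rev C B] at *
    rw [norm_sub_rev D C] at *
    linarith
  have f5 : r ≤ (b + c) * ‖A - C‖ + d * ‖A - D‖ + b * ‖B - C‖ + 2 * β * ‖B - C‖ := by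
    have h0 := h.viaC (b + c + d) (β + γ) d (β + b + (γ + c)) (by positivity) (by positivity)
      (by linarith) hd (by positivity) (by linarith)
    have e1 : (b + c + d) • A + β • B + γ • C - ((b + c + d) • A + (β + γ) • C)
      = β • (B - C) + (0 : ℝ) • (0 : V) := by module
    have e2 : ((b + c + d) • A + (β + γ) • C) - (d • D + (β + b + (γ + c)) • C)
      = (b + c) • (A - C) + d • (A - D) := by module
    have e3 : (d • D + (β + b + (γ + c)) • C) - ((β + b) • B + (γ + c) • C + d • D)
      = β • (C - B) + b • (C - B) := by module
    rw [e1, e2, e3] at h0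
    have := norm_smul_add_smul_le hβ le_rfl (B - C) 0
    have := norm_smul_add_smul_le (by positivity : 0 ≤ b + c) hd (A - C) (A - D)
    have := norm_smul_add_smul_le hβ hb (C - B) (C - B)
    rw [norm_sub_rev C B] at *
    linarith
  have f6 : r ≤ c * ‖A - C‖ + (d + b) * ‖A - D‖ + b * ‖B - D‖ + 2 * β * ‖B - C‖ := by
    have h0 := h.viaC (b + c + d) (β + γ) (d + b) (β + γ + c) (by positivity) (by positivity)
      (by linarith) (by positivity) (by positivity) (by linarith)
    have e1 : (b + c + d) • A + β • B + γ • C - ((b + c + d) • A + (β + γ) • C)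
      = β • (B - C) + (0 : ℝ) • (0 : V) := by module
    have e2 : ((b + c + d) • A + (β + γ) • C) - ((d + b) • D + (β + γ + c) • C)
      = c • (A - C) + (d + b) • (A - D) := by module
    have e3 : ((d + b) • D + (β + γ + c) • C) - ((β + b) • B + (γ + c) • C + d • D)
      = β • (C - B) + b • (D - B) := by module
    rw [e1, e2, e3] at h0
    have := norm_smul_add_smul_le hβ le_rfl (B - C) 0
    have := norm_smul_add_smul_le hc (by positivity : 0 ≤ d + b) (A - C) (A - D)
    have := norm_smul_add_smul_le hβ hb (C - B) (D - B)
    rw [norm_sub_rev C B] at *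
    rw [norm_sub_rev D B] at *
    linarith
  rcases (by positivity : 0 ≤ b + c + d).eq_or_lt' with h0 | hpos
  · have hb0 : b = 0 := by linarith
    have hc0 : c = 0 := by linarith
    have hd0 : d = 0 := by linarith
    simp only [hb0, hc0, hd0, zero_mul, add_zero] at f1
    linarith
  have hvert := vertex_cost_le hR hA hB hC hD hb hc hd
  have hBC := norm_sub_le_two_mul hB hC
  have hcommon : (γ * (b + d) + β * (c + d)) * ‖B - C‖ ≤ (b + c + d) * (β + γ) * (2 * R) := by
    refine mul_le_mul ?_ hBC (norm_nonneg _) (by positivity)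
    nlinarith [mul_nonneg hγ hc, mul_nonneg hβ hb]
  have hmain : (b + c + d) * r ≤ (b + c + d) * (23 / 10 * R * (b + c + d) + (β + γ) * (2 * R)) := by
    linarith [mul_le_mul_of_nonneg_left f1 hb, mul_le_mul_of_nonneg_left f2 hc,
      mul_le_mul_of_nonneg_left f3 hb, mul_le_mul_of_nonneg_left f4 hd,
      mul_le_mul_of_nonneg_left f5 hc, mul_le_mul_of_nonneg_left f6 hd]
  have hle := le_of_mul_le_mul_left hmain hpos
  have hk : b + c + d = 1 - (β + γ) := by linarith
  rw [hk] at hle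
  nlinarith [mul_nonneg (add_nonneg hβ hγ) hR.le]

/-- The case in which `x` dominates `y` at `B` and `y` dominates `x` at `C`:
`x = α A + (β + k) B + γ C` and `y = β B + (γ + g) C + δ D`. -/
theorem RouteBound.le_of_crossed {O A B C D : V} {R r α β γ δ g k : ℝ} (hR : 0 < R)
    (hA : ‖A - O‖ ≤ R) (hB : ‖B - O‖ ≤ R) (hC : ‖C - O‖ ≤ R) (hD : ‖D - O‖ ≤ R)
    (hβ : 0 ≤ β) (hγ : 0 ≤ γ) (hδ : 0 ≤ δ) (hk : 0 ≤ k) (hαδ : δ ≤ α)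
    (hsum : α + (β + k) + γ = 1) (hg : α + k = g + δ)
    (h : RouteBound A B C D (α • A + (β + k) • B + γ • C) (β • B + (γ + g) • C + δ • D) r) :
    r ≤ 23 / 10 * R := by
  obtain rfl : g = α + k - δ := by linarith
  have hAB := norm_sub_le_two_mul hA hB
  have hAC := norm_sub_le_two_mul hA hC
  have hAD := norm_sub_le_two_mul hA hD
  have hBC := norm_sub_le_two_mul hB hC
  have hBD := norm_sub_le_two_mul hB hD
  have hCD := norm_sub_le_two_mul hC hD
  have hα : 0 ≤ α := hδ.trans hαδ
  rcases le_total δ k with hδk | hkδ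
  · have h0 := h.viaBC (β + δ) (γ + (α + k - δ)) (by positivity) (by linarith) (by linarith)
    have e1 : α • A + (β + k) • B + γ • C - ((β + δ) • B + (γ + (α + k - δ)) • C)
      = α • (A - C) + (k - δ) • (B - C) := by module
    have e2 : ((β + δ) • B + (γ + (α + k - δ)) • C) - (β • B + (γ + (α + k - δ)) • C + δ • D)
      = δ • (B - D) + (0 : ℝ) • (0 : V) := by module
    rw [e1, e2] at h0
    have h1 := norm_smul_add_smul_le hα (sub_nonneg.2 hδk) (A - C) (B - C)
    have h2 := norm_smul_add_smul_le hδ le_rfl (B - D) 0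
    have h3 : (α + k) * (2 * R) ≤ 1 * (2 * R) :=
      mul_le_mul_of_nonneg_right (by linarith) (by positivity)
    linarith [mul_le_mul_of_nonneg_left hAC hα,
      mul_le_mul_of_nonneg_left hBC (sub_nonneg.2 hδk), mul_le_mul_of_nonneg_left hBD hδ]
  have hd : 0 ≤ δ - k := sub_nonneg.2 hkδ
  have hc : 0 ≤ α - δ := sub_nonneg.2 hαδ
  have f2 : r ≤ α * ‖A - C‖ + k * ‖B - D‖ + (δ - k) * ‖C - D‖ := by
    have h0 := h.viaBC (β + k) (γ + α) (by positivity) (by positivity) (by linarith)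
    have e1 : α • A + (β + k) • B + γ • C - ((β + k) • B + (γ + α) • C)
      = α • (A - C) + (0 : ℝ) • (0 : V) := by module
    have e2 : ((β + k) • B + (γ + α) • C) - (β • B + (γ + (α + k - δ)) • C + δ • D)
      = k • (B - D) + (δ - k) • (C - D) := by module
    rw [e1, e2] at h0
    have := norm_smul_add_smul_le hα le_rfl (A - C) 0
    have := norm_smul_add_smul_le hk hd (B - D) (C - D)
    linarith
  have f4 : r ≤ α * ‖A - D‖ + (α - δ) * ‖C - D‖ + (2 * γ + k) * ‖B - C‖ := by
    have h0 := h.viaB α (β + k + γ) α (β + k + γ) hα (by positivity)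
      (by linarith) hα (by positivity) (by linarith)
    have e1 : α • A + (β + k) • B + γ • C - (α • A + (β + k + γ) • B)
      = γ • (C - B) + (0 : ℝ) • (0 : V) := by module
    have e2 : (α • A + (β + k + γ) • B) - (α • D + (β + k + γ) • B)
      = α • (A - D) + (0 : ℝ) • (0 : V) := by module
    have e3 : (α • D + (β + k + γ) • B) - (β • B + (γ + (α + k - δ)) • C + δ • D)
      = (γ + k) • (B - C) + (α - δ) • (D - C) := by module
    rw [e1, e2, e3] at h0
    have := norm_smul_add_smul_le hγ le_rfl (C - B) 0
    have := norm_smul_add_smul_le hα le_rfl (A - D) 0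
    have := norm_smul_add_smul_le (by positivity : 0 ≤ γ + k) hc (B - C) (D - C)
    rw [norm_sub_rev C B] at *
    rw [norm_sub_rev D C] at *
    linarith
  have f5 : r ≤ (α - δ) * ‖A - C‖ + δ * ‖A - D‖ + (2 * β + k) * ‖B - C‖ := by
    have h0 := h.viaC α (β + k + γ) δ (β + (γ + (α + k - δ))) hα (by positivity)
      (by linarith) hδ (by linarith) (by linarith)
    have e1 : α • A + (β + k) • B + γ • C - (α • A + (β + k + γ) • C)
      = (β + k) • (B - C) + (0 : ℝ) • (0 : V) := by module
    have e2 : (α • A + (β + k + γ) • C) - (δ • D + (β + (γ + (α + k - δ))) • C)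
      = (α - δ) • (A - C) + δ • (A - D) := by module
    have e3 : (δ • D + (β + (γ + (α + k - δ))) • C) - (β • B + (γ + (α + k - δ)) • C + δ • D)
      = β • (C - B) + (0 : ℝ) • (0 : V) := by module
    rw [e1, e2, e3] at h0
    have := norm_smul_add_smul_le (by positivity : 0 ≤ β + k) le_rfl (B - C) 0
    have := norm_smul_add_smul_le hc hδ (A - C) (A - D)
    have := norm_smul_add_smul_le hβ le_rfl (C - B) 0
    rw [norm_sub_rev C B] at *
    linarith
  rcases (by linarith : 0 ≤ α - k).eq_or_lt' with h0 | hpos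
  · have hδk : δ - k = 0 := by linarith
    rw [hδk, zero_mul] at f2
    have h3 : (α + k) * (2 * R) ≤ 1 * (2 * R) :=
      mul_le_mul_of_nonneg_right (by linarith) (by positivity)
    linarith [mul_le_mul_of_nonneg_left hAC hα, mul_le_mul_of_nonneg_left hBD hk]
  have hvert := vertex_cost_le hR hA hB hC hD le_rfl hc hd
  have hM : 0 + (α - δ) + (δ - k) = α - k := by ring
  rw [hM] at hvert
  have hcommon : ((δ - k) * γ + (α - k) * β) * ‖B - C‖ ≤ (α - k) * (β + γ) * (2 * R) := by
    refine mul_le_mul ?_ hBC (norm_nonneg _) (by positivity)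
    nlinarith [mul_nonneg hγ hc]
  have hmain : (α - k) * r ≤ (α - k) * (23 / 10 * R * (α - k) + (β + γ + 2 * k) * (2 * R)) := by
    linarith [mul_le_mul_of_nonneg_left f2 hc, mul_le_mul_of_nonneg_left f4 hd,
      mul_le_mul_of_nonneg_left f5 hpos.le,
      mul_le_mul_of_nonneg_left hAC (mul_nonneg hc hk),
      mul_le_mul_of_nonneg_left hBD (mul_nonneg hc hk),
      mul_le_mul_of_nonneg_left hAD (mul_nonneg hd hk),
      mul_le_mul_of_nonneg_left hBC (mul_nonneg hd hk),
      mul_le_mul_of_nonneg_left hAD (mul_nonneg hpos.le hk),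
      mul_le_mul_of_nonneg_left hBC (mul_nonneg hpos.le hk)]
  have hle := le_of_mul_le_mul_left hmain hpos
  have hk' : α - k = 1 - (β + γ + 2 * k) := by linarith
  rw [hk'] at hle
  nlinarith [mul_nonneg (by positivity : 0 ≤ β + γ + 2 * k) hR.le]

theorem RouteBound.le_of_le {O A B C D : V} {R r α β γ β' γ' δ : ℝ} (hR : 0 < R)
    (hA : ‖A - O‖ ≤ R) (hB : ‖B - O‖ ≤ R) (hC : ‖C - O‖ ≤ R) (hD : ‖D - O‖ ≤ R)
    (hβ : 0 ≤ β) (hγ : 0 ≤ γ) (hβ' : 0 ≤ β') (hγ' : 0 ≤ γ') (hδ : 0 ≤ δ)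
    (hx : α + β + γ = 1) (hy : β' + γ' + δ = 1) (hαδ : δ ≤ α)
    (h : RouteBound A B C D (α • A + β • B + γ • C) (β' • B + γ' • C + δ • D) r) :
    r ≤ 23 / 10 * R := by
  rcases lt_or_ge β' β with hlt | hBle
  · refine le_of_crossed (β := β') (k := β - β') (γ := γ) (g := γ' - γ) hR hA hB hC hD hβ' hγ hδ
      (by linarith) hαδ (by linarith) (by linarith) ?_
    simpa only [add_sub_cancel] using h
  rcases lt_or_ge γ' γ with hlt | hCle
  · refine le_of_crossed (β := γ') (k := γ - γ') (γ := β) (g := β' - β) hR hA hC hB hD hγ' hβ hδ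
      (by linarith) hαδ (by linarith) (by linarith) ?_
    simpa only [add_sub_cancel, add_right_comm, add_comm (γ' • C)] using h.swap
  · refine le_of_dominated (β := β) (γ := γ) (b := β' - β) (c := γ' - γ) (d := δ) hR hA hB hC hD
      hβ hγ (by linarith) (by linarith) hδ (by linarith) ?_
    have : β' - β + (γ' - γ) + δ = α := by linarith
    simpa only [add_sub_cancel, this] using h

theorem RouteBound.le {O A B C D : V} {R r α β γ β' γ' δ : ℝ} (hR : 0 < R)
    (hA : ‖A - O‖ ≤ R) (hB : ‖B - O‖ ≤ R) (hC : ‖C - O‖ ≤ R) (hD : ‖D - O‖ ≤ R)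
    (hα : 0 ≤ α) (hβ : 0 ≤ β) (hγ : 0 ≤ γ) (hβ' : 0 ≤ β') (hγ' : 0 ≤ γ') (hδ : 0 ≤ δ)
    (hx : α + β + γ = 1) (hy : β' + γ' + δ = 1)
    (h : RouteBound A B C D (α • A + β • B + γ • C) (β' • B + γ' • C + δ • D) r) :
    r ≤ 23 / 10 * R := by
  rcases le_total δ α with hαδ | hαδ
  · exact h.le_of_le hR hA hB hC hD hβ hγ hβ' hγ' hδ hx hy hαδ
  · refine le_of_le (A := D) (D := A) (α := δ) (β := β') (γ := γ') (β' := β) (γ' := γ) (δ := α)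
      hR hD hB hC hA hβ' hγ' hβ hγ hα (by linarith) (by linarith) hαδ ?_
    have := h.reverse
    rwa [show α • A + β • B + γ • C = β • B + γ • C + α • A by abel,
      show β' • B + γ' • C + δ • D = δ • D + β' • B + γ' • C by abel] at this

end TransportBounds

section IntrinsicDistance

variable {T : Set (EuclideanSpace ℝ (Fin 3))} {x y z : EuclideanSpace ℝ (Fin 3)}

theorem edist_le_rho : edist x y ≤ rho T x y := by
  refine le_iInf fun γ => le_iInf fun _ => le_iInf fun h0 => le_iInf fun h1 => le_iInf fun _ => ?_
  rw [← h0, ← h1]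
  exact eVariationOn.edist_le γ (by simp) (by simp)

theorem rho_le_edist_of_segment_subset (h : segment ℝ x y ⊆ T) :
    rho T x y ≤ edist x y := by
  refine iInf_le_of_le (fun t => AffineMap.lineMap x y t) (iInf_le_of_le (by fun_prop)
    (iInf_le_of_le (by simp) (iInf_le_of_le (by simp) (iInf_le_of_le (fun t ht => h ?_) ?_))))
  · rw [segment_eq_image_lineMap]
    exact ⟨t, ht, rfl⟩
  · have hlip := ((lipschitzWith_lineMap (𝕜 := ℝ) x y).lipschitzOnWith
      (s := Set.univ)).comp_eVariationOn_le (g := id) (s := Set.Icc (0 : ℝ) 1)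
      (fun _ _ => Set.mem_univ _)
    rw [eVariationOn_id_Icc, sub_zero, ENNReal.ofReal_one, mul_one] at hlip
    rw [edist_nndist]
    exact hlip

theorem rho_triangle : rho T x z ≤ rho T x y + rho T y z := by
  simp only [rho, ENNReal.iInf_add, ENNReal.add_iInf]
  refine le_iInf fun g => le_iInf fun hg => le_iInf fun hg0 => le_iInf fun hg1 => le_iInf fun hgT =>
    le_iInf fun f => le_iInf fun hf => le_iInf fun hf0 => le_iInf fun hf1 => le_iInf fun hfT => ?_
  set γ : ℝ → EuclideanSpace ℝ (Fin 3) :=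
    fun t => if t ≤ 1 / 2 then f (2 * t) else g (2 * t - 1) with hγ
  have hleft : Set.EqOn γ (f ∘ fun t => 2 * t) (Set.Icc 0 (1 / 2)) := fun t ht => by
    simp only [hγ, if_pos ht.2, Function.comp_apply]
  have hright : Set.EqOn γ (g ∘ fun t => 2 * t - 1) (Set.Icc (1 / 2) 1) := fun t ht => by
    rcases ht.1.eq_or_lt with rfl | hlt
    · norm_num [hγ, hf1, hg0]
    · simp only [hγ, if_neg hlt.not_ge, Function.comp_apply]
  refine iInf_le_of_le γ (iInf_le_of_le ?_ (iInf_le_of_le ?_ (iInf_le_of_le ?_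
    (iInf_le_of_le ?_ ?_))))
  · refine Continuous.if_le (by fun_prop) (by fun_prop) continuous_id continuous_const ?_
    rintro t rfl
    norm_num [hf1, hg0]
  · simp [hγ, hf0]
  · norm_num [hγ, hg1]
  · intro t ht
    rcases le_total t (1 / 2) with h | h
    · rw [hleft ⟨ht.1, h⟩]
      exact hfT _ ⟨by linarith [ht.1], by linarith⟩
    · rw [hright ⟨h, ht.2⟩]
      exact hgT _ ⟨by linarith, by linarith [ht.2]⟩
  · have hsplit := eVariationOn.Icc_add_Icc γ (s := Set.univ) (a := 0) (b := 1 / 2) (c := 1)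
      (by norm_num) (by norm_num) (Set.mem_univ _)
    simp only [Set.univ_inter] at hsplit
    rw [← hsplit, eVariationOn.congr hleft, eVariationOn.congr hright]
    refine add_le_add (eVariationOn.comp_le_of_monotoneOn _ _ ?_ ?_)
      (eVariationOn.comp_le_of_monotoneOn _ _ ?_ ?_)
    · intro s _ t _ hst
      dsimp only
      linarith
    · intro t ht
      exact ⟨by linarith [ht.1], by linarith [ht.2]⟩
    · intro s _ t _ hst
      dsimp only
      linarith
    · intro t ht
      exact ⟨by linarith [ht.1], by linarith [ht.2]⟩

end IntrinsicDistance

namespace AffineBasis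

theorem mem_frontier_convexHull {ι E : Type*} [Finite ι] [NormedAddCommGroup E]
    [NormedSpace ℝ E] (b : AffineBasis ι ℝ E) {x : E} :
    x ∈ frontier (convexHull ℝ (Set.range b)) ↔ (∀ i, 0 ≤ b.coord i x) ∧ ∃ i, b.coord i x = 0 := by
  have hclosed : IsClosed (convexHull ℝ (Set.range b)) :=
    ((Set.finite_range b).isCompact_convexHull (𝕜 := ℝ)).isClosed
  rw [hclosed.frontier_eq, b.interior_convexHull, b.convexHull_eq_nonneg_coord]
  simp only [Set.mem_sdiff, Set.mem_ofPred_eq, not_forall, not_lt]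
  refine and_congr_right fun h => exists_congr fun i => ?_
  exact ⟨fun hi => hi.antisymm (h i), fun hi => hi.le⟩

variable (b : AffineBasis (Fin 4) ℝ (EuclideanSpace ℝ (Fin 3)))
  {x y p q : EuclideanSpace ℝ (Fin 3)}

theorem rho_frontier_le_edist (hx : ∀ i, 0 ≤ b.coord i x) (hy : ∀ i, 0 ≤ b.coord i y)
    (hxy : ∃ i, b.coord i x = 0 ∧ b.coord i y = 0) :
    rho (frontier (convexHull ℝ (Set.range b))) x y ≤ edist x y := by
  refine rho_le_edist_of_segment_subset ?_
  rintro _ ⟨s, t, hs, ht, hst, rfl⟩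
  rw [b.mem_frontier_convexHull]
  simp only [Convex.combo_affine_apply hst, smul_eq_mul]
  obtain ⟨i, hi, hi'⟩ := hxy
  exact ⟨fun j => add_nonneg (mul_nonneg hs (hx j)) (mul_nonneg ht (hy j)), i, by simp [hi, hi']⟩

theorem rho_frontier_le_ofReal (hx : ∀ i, 0 ≤ b.coord i x) (hp : ∀ i, 0 ≤ b.coord i p)
    (hq : ∀ i, 0 ≤ b.coord i q) (hy : ∀ i, 0 ≤ b.coord i y)
    (hxp : ∃ i, b.coord i x = 0 ∧ b.coord i p = 0) (hpq : ∃ i, b.coord i p = 0 ∧ b.coord i q = 0)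
    (hqy : ∃ i, b.coord i q = 0 ∧ b.coord i y = 0) :
    rho (frontier (convexHull ℝ (Set.range b))) x y ≤
      ENNReal.ofReal (‖x - p‖ + ‖p - q‖ + ‖q - y‖) := by
  rw [ENNReal.ofReal_add (by positivity) (by positivity),
    ENNReal.ofReal_add (by positivity) (by positivity), ← dist_eq_norm, ← dist_eq_norm,
    ← dist_eq_norm, ← edist_dist, ← edist_dist, ← edist_dist]
  refine (rho_triangle (y := q)).trans
    (add_le_add ((rho_triangle (y := p)).trans (add_le_add ?_ ?_)) ?_)
  · exact b.rho_frontier_le_edist hx hp hxp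
  · exact b.rho_frontier_le_edist hp hq hpq
  · exact b.rho_frontier_le_edist hq hy hqy

theorem rho_frontier_le_of_faces {O : EuclideanSpace ℝ (Fin 3)} {R : ℝ} (hR : 0 < R)
    (hO : ∀ i, ‖b i - O‖ ≤ R) (hx : ∀ i, 0 ≤ b.coord i x) (hy : ∀ i, 0 ≤ b.coord i y)
    (hx3 : b.coord 3 x = 0) (hy0 : b.coord 0 y = 0) :
    rho (frontier (convexHull ℝ (Set.range b))) x y ≤ ENNReal.ofReal (23 / 10 * R) := by
  have hcoord : ∀ {s t : ℝ} (i j k : Fin 4), s + t = 1 → b.coord k (s • b i + t • b j) =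
      s * (if k = i then 1 else 0) + t * (if k = j then 1 else 0) := fun i j k hst => by
    rw [Convex.combo_affine_apply hst, b.coord_apply, b.coord_apply, smul_eq_mul, smul_eq_mul]
  have hnonneg : ∀ {s t : ℝ} (i j : Fin 4), 0 ≤ s → 0 ≤ t → s + t = 1 →
      ∀ k, 0 ≤ b.coord k (s • b i + t • b j) := fun i j hs ht hst k => by
    rw [hcoord i j k hst]
    split_ifs <;> simp [hs, ht, add_nonneg]
  have hBC : ∀ s t : ℝ, 0 ≤ s → 0 ≤ t → s + t = 1 →
      rho (frontier (convexHull ℝ (Set.range b))) x y ≤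
        ENNReal.ofReal (‖x - (s • b 1 + t • b 2)‖ + ‖(s • b 1 + t • b 2) - y‖) := by
    intro s t hs ht hst
    have hp := hnonneg 1 2 hs ht hst
    have := b.rho_frontier_le_ofReal hx hp hp hy ⟨3, hx3, by simp [hcoord 1 2 3 hst]⟩
      ⟨3, by simp [hcoord 1 2 3 hst], by simp [hcoord 1 2 3 hst]⟩
      ⟨0, by simp [hcoord 1 2 0 hst], hy0⟩
    rwa [sub_self, norm_zero, add_zero] at this
  have hne : rho (frontier (convexHull ℝ (Set.range b))) x y ≠ ⊤ :=
    ne_top_of_le_ne_top ENNReal.ofReal_ne_top (hBC 1 0 zero_le_one le_rfl (by norm_num))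
  have hx_eq : x = b.coord 0 x • b 0 + b.coord 1 x • b 1 + b.coord 2 x • b 2 := by
    have := b.linear_combination_coord_eq_self x
    rw [Fin.sum_univ_four, hx3, zero_smul, add_zero] at this
    exact this.symm
  have hy_eq : y = b.coord 1 y • b 1 + b.coord 2 y • b 2 + b.coord 3 y • b 3 := by
    have := b.linear_combination_coord_eq_self y
    rw [Fin.sum_univ_four, hy0, zero_smul, zero_add] at this
    exact this.symm
  have hx_sum := b.sum_coord_apply_eq_one x
  have hy_sum := b.sum_coord_apply_eq_one y
  rw [Fin.sum_univ_four, hx3, add_zero] at hx_sum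
  rw [Fin.sum_univ_four, hy0, zero_add] at hy_sum
  have hroutes : RouteBound (b 0) (b 1) (b 2) (b 3) x y
      (rho (frontier (convexHull ℝ (Set.range b))) x y).toReal := by
    refine ⟨fun s t hs ht hst => ?_, fun s t u v hs ht hst hu hv huv => ?_,
      fun s t u v hs ht hst hu hv huv => ?_⟩ <;>
      refine ENNReal.toReal_le_of_le_ofReal (by positivity) ?_
    · exact hBC s t hs ht hst
    · exact b.rho_frontier_le_ofReal hx (hnonneg 0 1 hs ht hst) (hnonneg 3 1 hu hv huv) hy
        ⟨3, hx3, by simp [hcoord 0 1 3 hst]⟩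
        ⟨2, by simp [hcoord 0 1 2 hst], by simp [hcoord 3 1 2 huv]⟩
        ⟨0, by simp [hcoord 3 1 0 huv], hy0⟩
    · exact b.rho_frontier_le_ofReal hx (hnonneg 0 2 hs ht hst) (hnonneg 3 2 hu hv huv) hy
        ⟨3, hx3, by simp [hcoord 0 2 3 hst]⟩
        ⟨1, by simp [hcoord 0 2 1 hst], by simp [hcoord 3 2 1 huv]⟩
        ⟨0, by simp [hcoord 3 2 0 huv], hy0⟩
  rw [ENNReal.le_ofReal_iff_toReal_le hne (by positivity)]
  generalize (rho (frontier (convexHull ℝ (Set.range b))) x y).toReal = r at hroutes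
  rw [hx_eq, hy_eq] at hroutes
  exact hroutes.le hR (hO 0) (hO 1) (hO 2) (hO 3) (hx 0) (hx 1) (hx 2) (hy 1) (hy 2) (hy 3)
    hx_sum hy_sum

/-- The surface of a tetrahedron contained in a ball of radius `R` has intrinsic diameter at most
`2.3 R`. -/
theorem intrinsicDiam_frontier_le {O : EuclideanSpace ℝ (Fin 3)} {R : ℝ} (hR : 0 < R)
    (hO : ∀ i, ‖b i - O‖ ≤ R) :
    intrinsicDiam (frontier (convexHull ℝ (Set.range b))) ≤ ENNReal.ofReal (23 / 10 * R) := by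
  refine iSup₂_le fun x hx => iSup₂_le fun y hy => ?_
  obtain ⟨hx, i, hxi⟩ := b.mem_frontier_convexHull.1 hx
  obtain ⟨hy, j, hyj⟩ := b.mem_frontier_convexHull.1 hy
  have hperm : ∀ i j : Fin 4, i ≠ j → ∃ σ : Equiv.Perm (Fin 4), σ 3 = i ∧ σ 0 = j := by decide
  by_cases hij : i = j
  · subst hij
    refine (b.rho_frontier_le_edist hx hy ⟨i, hxi, hyj⟩).trans ?_
    have hball : convexHull ℝ (Set.range b) ⊆ Metric.closedBall O R :=
      convexHull_min (by rintro _ ⟨i, rfl⟩; simpa [dist_eq_norm] using hO i)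
        (convex_closedBall O R)
    rw [b.convexHull_eq_nonneg_coord] at hball
    have hxy := dist_triangle_right x y O
    have hxO := Metric.mem_closedBall.1 (hball hx)
    have hyO := Metric.mem_closedBall.1 (hball hy)
    rw [edist_dist]
    exact ENNReal.ofReal_le_ofReal (by linarith)
  · obtain ⟨σ, rfl, rfl⟩ := hperm i j hij
    have := (b.reindex σ.symm).rho_frontier_le_of_faces (x := x) (y := y) hR
      (fun i => by simpa using hO (σ i)) (fun i => by simpa using hx (σ i))
      (fun i => by simpa using hy (σ i)) (by simpa using hxi) (by simpa using hyj)
    rwa [b.coe_reindex, σ.symm.symm.surjective.range_comp] at this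

end AffineBasis

theorem vertex_mem_frontier (b : AffineBasis (Fin 4) ℝ (EuclideanSpace ℝ (Fin 3)))
    (i : Fin 4) : b i ∈ frontier (convexHull ℝ (Set.range b)) := by
  have hne : ∀ i : Fin 4, ∃ k, k ≠ i := by decide
  obtain ⟨k, hk⟩ := hne i
  rw [b.mem_frontier_convexHull]
  refine ⟨fun j => ?_, k, by rw [b.coord_apply, if_neg hk]⟩
  rw [b.coord_apply]
  split_ifs <;> norm_num

theorem intrinsicDiam_le_mul_extrinsicRad
    (b : AffineBasis (Fin 4) ℝ (EuclideanSpace ℝ (Fin 3))) :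
    intrinsicDiam (frontier (convexHull ℝ (Set.range b))) ≤
      ENNReal.ofReal (23 / 10) * extrinsicRad (frontier (convexHull ℝ (Set.range b))) := by
  have hne : ENNReal.ofReal (23 / 10) ≠ 0 := by norm_num
  rw [← ENNReal.div_le_iff' hne ENNReal.ofReal_ne_top]
  refine le_iInf₂ fun x _ => (ENNReal.div_le_iff' hne ENNReal.ofReal_ne_top).2 ?_
  set s := ⨆ y ∈ frontier (convexHull ℝ (Set.range b)), edist x y with hs
  have hvert : ∀ i, edist x (b i) ≤ s := fun i => le_iSup₂_of_le _ (vertex_mem_frontier b i) le_rfl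
  rcases eq_or_ne s ⊤ with htop | htop
  · rw [htop, ENNReal.mul_top hne]
    exact le_top
  have hO : ∀ i, ‖b i - x‖ ≤ s.toReal := fun i => by
    rw [← dist_eq_norm, dist_comm, dist_edist]
    exact ENNReal.toReal_mono htop (hvert i)
  have hpos : 0 < s.toReal := by
    have h01 : 0 < ‖b 0 - b 1‖ := norm_sub_pos_iff.2 (b.ind.injective.ne (by decide))
    linarith [norm_sub_le_two_mul (hO 0) (hO 1)]
  have := b.intrinsicDiam_frontier_le hpos hO
  rwa [ENNReal.ofReal_mul (by norm_num), ENNReal.ofReal_toReal htop] at this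

theorem extrinsicRad_lt_intrinsicDiam
    (b : AffineBasis (Fin 4) ℝ (EuclideanSpace ℝ (Fin 3))) :
    extrinsicRad (frontier (convexHull ℝ (Set.range b))) <
      intrinsicDiam (frontier (convexHull ℝ (Set.range b))) := by
  obtain ⟨⟨i, j⟩, -, hmax⟩ := Finset.exists_max_image (Finset.univ : Finset (Fin 4 × Fin 4))
    (fun k => dist (b k.1) (b k.2)) Finset.univ_nonempty
  set L := dist (b i) (b j) with hL
  have hLpos : 0 < L := (dist_pos.2 (b.ind.injective.ne (by decide : (0 : Fin 4) ≠ 1))).trans_le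
    (hmax (0, 1) (Finset.mem_univ _))
  have hLle : ENNReal.ofReal L ≤ intrinsicDiam (frontier (convexHull ℝ (Set.range b))) := by
    rw [hL, ← edist_dist]
    exact edist_le_rho.trans (le_iSup₂_of_le _ (vertex_mem_frontier b i)
      (le_iSup₂_of_le _ (vertex_mem_frontier b j) le_rfl))
  refine lt_of_le_of_lt ?_ ((ENNReal.ofReal_lt_ofReal_iff hLpos).2
    (by linarith : 9 / 10 * L < L) |>.trans_le hLle)
  set m := (2⁻¹ : ℝ) • b i + (2⁻¹ : ℝ) • b j with hm
  have hhalf : (2⁻¹ : ℝ) + 2⁻¹ = 1 := by norm_num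
  have hmT : m ∈ frontier (convexHull ℝ (Set.range b)) := by
    have hne : ∀ i j : Fin 4, ∃ k, k ≠ i ∧ k ≠ j := by decide
    obtain ⟨k, hki, hkj⟩ := hne i j
    rw [b.mem_frontier_convexHull]
    simp only [hm, Convex.combo_affine_apply hhalf, b.coord_apply, smul_eq_mul]
    refine ⟨fun l => by split_ifs <;> norm_num, k, by simp [hki, hkj]⟩
  have hball : convexHull ℝ (Set.range b) ⊆ Metric.closedBall m (9 / 10 * L) := by
    refine convexHull_min ?_ (convex_closedBall _ _)
    rintro _ ⟨k, rfl⟩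
    rw [Metric.mem_closedBall, dist_eq_norm]
    have h1 := hmax (k, i) (Finset.mem_univ _)
    have h2 := hmax (k, j) (Finset.mem_univ _)
    simp only [dist_eq_norm] at h1 h2 hL
    have hpar := parallelogram_law_with_norm ℝ (b k - b i) (b k - b j)
    have e1 : b k - b i + (b k - b j) = (2 : ℝ) • (b k - m) := by rw [hm]; module
    have e2 : b k - b i - (b k - b j) = -(b i - b j) := by abel
    rw [e1, e2, norm_neg, norm_smul, Real.norm_ofNat, ← hL] at hpar
    have h3 := mul_self_le_mul_self (norm_nonneg _) h1
    have h4 := mul_self_le_mul_self (norm_nonneg _) h2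
    exact abs_le_of_sq_le_sq' (by nlinarith) (by positivity) |>.2
  refine iInf₂_le_of_le m hmT (iSup₂_le fun y hy => ?_)
  have hclosed : IsClosed (convexHull ℝ (Set.range b)) :=
    ((Set.finite_range b).isCompact_convexHull (𝕜 := ℝ)).isClosed
  rw [edist_comm, edist_dist]
  exact ENNReal.ofReal_le_ofReal (Metric.mem_closedBall.1 (hball (hclosed.frontier_subset hy)))

theorem stmt5 (a b c d : EuclideanSpace ℝ (Fin 3))
    (hind : AffineIndependent ℝ ![a, b, c, d])
    (T : Set (EuclideanSpace ℝ (Fin 3)))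
    (hT : T = frontier (convexHull ℝ ({a, b, c, d} : Set (EuclideanSpace ℝ (Fin 3))))) :
    ENNReal.ofReal (Real.sqrt 3 / 4) * intrinsicDiam T < extrinsicRad T ∧
      extrinsicRad T < intrinsicDiam T := by
  let B : AffineBasis (Fin 4) ℝ (EuclideanSpace ℝ (Fin 3)) :=
    ⟨![a, b, c, d], hind, hind.affineSpan_eq_top_iff_card_eq_finrank_add_one.2 (by simp)⟩
  have hrange : Set.range B = {a, b, c, d} := by
    change Set.range ![a, b, c, d] = _
    simp only [Matrix.range_cons, Matrix.range_empty, Set.union_empty, Set.singleton_union]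
  rw [← hrange] at hT
  subst hT
  have hlt := extrinsicRad_lt_intrinsicDiam B
  have hle := intrinsicDiam_le_mul_extrinsicRad B
  refine ⟨?_, hlt⟩
  set ρ := extrinsicRad (frontier (convexHull ℝ (Set.range B)))
  have hne_top : ρ ≠ ⊤ := hlt.ne_top
  have hne_zero : ρ ≠ 0 := by
    intro h0
    rw [h0, mul_zero] at hle
    exact not_lt_bot (hlt.trans_le hle)
  calc ENNReal.ofReal (Real.sqrt 3 / 4) * intrinsicDiam (frontier (convexHull ℝ (Set.range B)))
      ≤ ENNReal.ofReal (Real.sqrt 3 / 4) * (ENNReal.ofReal (23 / 10) * ρ) := by gcongr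
    _ = ENNReal.ofReal (Real.sqrt 3 / 4 * (23 / 10)) * ρ := by
        rw [← mul_assoc, ENNReal.ofReal_mul (by positivity)]
    _ < 1 * ρ := by
        refine ENNReal.mul_lt_mul_left hne_zero hne_top ?_
        rw [ENNReal.ofReal_lt_one]
        nlinarith [Real.sq_sqrt (show (0 : ℝ) ≤ 3 by norm_num), Real.sqrt_nonneg 3]
    _ = ρ := one_mul ρ
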